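/- arXiv:1305.5858 — 8 statements merged into one kernel-verified Lean document; each statement's English description precedes it below -/
import Mathlib

section
/- Birkhoff's recurrence theorem: Let X be a nonempty compact topological space and T : X → X a continuous map. Then there exists a point x ∈ X that is a recurrent point of T, i.e., for every neighborhood U of x and every N ∈ ℕ there exists n ≥ N with T^[n] x ∈ U. -/
open Set in
/-- A continuous self-map of a nonempty compact space has a minimal nonempty closed
forward-invariant set. -/
theorem exists_minimal_isClosed_mapsTo {X : Type*} [TopologicalSpace X] [CompactSpace X]
    [Nonempty X] (T : X → X) :
    ∃ M : Set X, Minimal (fun s => IsClosed s ∧ s.Nonempty ∧ MapsTo T s s) M := by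
  refine zorn_superset {s : Set X | IsClosed s ∧ s.Nonempty ∧ MapsTo T s s} fun c hc hchain => ?_
  obtain rfl | hne := c.eq_empty_or_nonempty
  · exact ⟨univ, ⟨isClosed_univ, univ_nonempty, mapsTo_univ _ _⟩, by simp⟩
  refine ⟨⋂₀ c, ⟨isClosed_sInter fun s hs => (hc hs).1, ?_, fun x hx s hs =>
    (hc hs).2.2 (hx s hs)⟩, fun s hs => sInter_subset_of_mem hs⟩
  have : Nonempty c := hne.to_subtype
  exact IsCompact.nonempty_sInter_of_directed_nonempty_isCompact_isClosed
    (IsChain.directedOn (r := fun s t : Set X => s ⊇ t) hchain.symm) (fun s hs => (hc hs).2.1)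
    (fun s hs => (hc hs).1.isCompact) (fun s hs => (hc hs).1)

/-- Birkhoff's recurrence theorem: every continuous self-map of a nonempty
compact topological space has a recurrent point. -/
theorem birkhoff_recurrence (X : Type*) [TopologicalSpace X] [CompactSpace X]
    [Nonempty X] (T : X → X) (hT : Continuous T) :
    ∃ x : X, ∀ U ∈ nhds x, ∀ N : ℕ, ∃ n ≥ N, T^[n] x ∈ U := by
  obtain ⟨M, ⟨hclosed, ⟨x, hx⟩, hmaps⟩, hmin⟩ := exists_minimal_isClosed_mapsTo T
  refine ⟨x, fun U hU N => ?_⟩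
  let A : Set X := (fun n => T^[n] x) '' Set.Ici N
  have hAM : closure A ⊆ M := by
    refine closure_minimal ?_ hclosed
    rintro _ ⟨n, -, rfl⟩
    exact hmaps.iterate n hx
  have hA : Set.MapsTo T A A := by
    rintro _ ⟨n, hn, rfl⟩
    exact ⟨n + 1, le_trans hn n.le_succ, Function.iterate_succ_apply' T n x⟩
  have hxA : x ∈ closure A :=
    hmin ⟨isClosed_closure, (Set.nonempty_Ici.image _).closure, hA.closure hT⟩ hAM hx
  obtain ⟨_, hU, n, hn, rfl⟩ := mem_closure_iff_nhds.1 hxA U hU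
  exact ⟨n, hn, hU⟩
end

section
/- Birkhoff's recurrence theorem (metric version): Let X be a nonempty compact metric space and T : X → X a continuous map. Then there exist a point x ∈ X and a strictly increasing sequence n₁ < n₂ < ⋯ of natural numbers such that the sequence T^[nᵢ] x converges to x. -/
/-- A continuous self-map of a nonempty compact space has a point which is a cluster point of its
own forward orbit. -/
theorem exists_mapClusterPt_iterate_self {X : Type*} [TopologicalSpace X] [CompactSpace X]
    [Nonempty X] {T : X → X} (hT : Continuous T) :
    ∃ x : X, MapClusterPt x Filter.atTop (fun n => T^[n] x) := by
  let S : Set (Set X) := {s | IsClosed s ∧ s.Nonempty ∧ Set.MapsTo T s s}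
  obtain ⟨M, -, hM⟩ : ∃ M, M ⊆ Set.univ ∧ Minimal (· ∈ S) M := by
    refine zorn_superset_nonempty S (fun c hcS hc hne => ?_) Set.univ
      ⟨isClosed_univ, Set.univ_nonempty, Set.mapsTo_univ _ _⟩
    have : Nonempty c := hne.to_subtype
    have hdir : DirectedOn (fun s t : Set X => s ⊇ t) c := fun s hs t ht =>
      (hc.total hs ht).elim (fun h => ⟨s, hs, subset_rfl, h⟩) fun h => ⟨t, ht, h, subset_rfl⟩
    refine ⟨⋂₀ c, ⟨isClosed_sInter fun s hs => (hcS hs).1, ?_, ?_⟩,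
      fun s hs => Set.sInter_subset_of_mem hs⟩
    · exact IsCompact.nonempty_sInter_of_directed_nonempty_isCompact_isClosed
        hdir (fun s hs => (hcS hs).2.1)
        (fun s hs => (hcS hs).1.isCompact) (fun s hs => (hcS hs).1)
    · exact fun x hx s hs => (hcS hs).2.2 (hx s hs)
  obtain ⟨hMcl, ⟨x, hx⟩, hMT⟩ := hM.prop
  let W : Set X := {y | MapClusterPt y Filter.atTop (fun n => T^[n] x)}
  have hWM : W ⊆ M := fun y hy => hMcl.mem_of_mapClusterPt hy
    (Filter.Eventually.of_forall fun n => hMT.iterate n hx)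
  have hW : W ∈ S := by
    refine ⟨isClosed_setOfPred_clusterPt, exists_clusterPt_of_compactSpace _, fun y hy => ?_⟩
    have h : MapClusterPt (T y) Filter.atTop (T ∘ fun n => T^[n] x) :=
      MapClusterPt.continuousAt_comp hT.continuousAt hy
    refine MapClusterPt.of_comp (Filter.tendsto_add_atTop_nat 1) ?_
    simpa only [Function.comp_def, Function.iterate_succ_apply'] using h
  exact ⟨x, hM.le_of_le hW hWM hx⟩

/-- Birkhoff's recurrence theorem, metric version: there is a point `x` and a
strictly increasing sequence `n i` of natural numbers with `T^[n i] x → x`. -/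
theorem birkhoff_recurrence_metric (X : Type*) [MetricSpace X] [CompactSpace X]
    [Nonempty X] (T : X → X) (hT : Continuous T) :
    ∃ (x : X) (n : ℕ → ℕ), StrictMono n ∧
      Filter.Tendsto (fun i => T^[n i] x) Filter.atTop (nhds x) := by
  obtain ⟨x, hx⟩ := exists_mapClusterPt_iterate_self hT
  obtain ⟨n, hn, h⟩ := hx.tendsto_subseq
  exact ⟨x, n, hn, h⟩
end

section
/- Every point of a minimal system is almost periodic: Let X be a nonempty compact topological space and T : X → X a continuous map such that every nonempty closed set D ⊆ X with T '' D ⊆ D equals X. Then every x ∈ X is an almost periodic point of T, i.e., for every neighborhood U of x there exists b ∈ ℕ such that for every n ∈ ℕ there exists k < b with T^[n+k] x ∈ U. -/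
/-- Every point of a minimal system is almost periodic. -/
theorem minimal_imp_almost_periodic (X : Type*) [TopologicalSpace X]
    [CompactSpace X] [Nonempty X] (T : X → X) (hT : Continuous T)
    (hmin : ∀ D : Set X, D.Nonempty → IsClosed D → T '' D ⊆ D → D = Set.univ) :
    ∀ x : X, ∀ U ∈ nhds x, ∃ b : ℕ, ∀ n : ℕ, ∃ k < b, T^[n + k] x ∈ U := by
  intro x U hU
  obtain ⟨V, hVU, hV, hxV⟩ := mem_nhds_iff.mp hU
  have hopen : ∀ k, IsOpen (T^[k] ⁻¹' V) := fun k => hV.preimage (hT.iterate k)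
  -- The points whose orbit avoids `V` form a closed invariant set missing `x`.
  have hcover : Set.univ ⊆ ⋃ k, T^[k] ⁻¹' V := by
    by_contra hne
    obtain ⟨y, -, hy⟩ := Set.not_subset.mp hne
    have hD := hmin (⋃ k, T^[k] ⁻¹' V)ᶜ ⟨y, hy⟩ (isOpen_iUnion hopen).isClosed_compl (by
      rintro _ ⟨z, hz, rfl⟩ hTz
      obtain ⟨k, hk⟩ := Set.mem_iUnion.mp hTz
      exact hz (Set.mem_iUnion.mpr ⟨k + 1, hk⟩))
    have hx : x ∈ (⋃ k, T^[k] ⁻¹' V)ᶜ := hD ▸ Set.mem_univ x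
    exact hx (Set.mem_iUnion.mpr ⟨0, hxV⟩)
  obtain ⟨t, ht⟩ := isCompact_univ.elim_finite_subcover _ hopen hcover
  refine ⟨t.sup id + 1, fun n => ?_⟩
  obtain ⟨k, hkt, hk⟩ := Set.mem_iUnion₂.mp (ht (Set.mem_univ (T^[n] x)))
  refine ⟨k, Nat.lt_succ_of_le (Finset.le_sup (f := id) hkt), hVU ?_⟩
  rwa [add_comm, Function.iterate_add_apply]
end

section
/- Bounded-gap return lemma for piecewise iterates: Let X be a set, F : X → X a function, b ∈ ℕ, and j : X → ℕ a function with 1 ≤ j x ≤ b for all x ∈ X. Define G : X → X by G x = F^[j x] x. Let D ⊆ X be a set with G '' D ⊆ D. Then for every x ∈ D and every n ∈ ℕ there exists k with 1 ≤ k ≤ b such that F^[n+k] x ∈ D. -/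
/-- Bounded-gap return lemma for piecewise iterates: if `G x = F^[j x] x` with
`1 ≤ j x ≤ b`, and `D` is invariant under `G`, then from any point of `D` the
`F`-orbit returns to `D` with gaps at most `b`. -/
theorem bounded_gap_return (X : Type*) (F : X → X) (b : ℕ) (j : X → ℕ)
    (hj : ∀ x : X, 1 ≤ j x ∧ j x ≤ b) (D : Set X)
    (hD : (fun x => F^[j x] x) '' D ⊆ D) :
    ∀ x ∈ D, ∀ n : ℕ, ∃ k : ℕ, 1 ≤ k ∧ k ≤ b ∧ F^[n + k] x ∈ D := by
  intro x hx n
  induction n using Nat.strong_induction_on generalizing x with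
  | _ n ih =>
    obtain ⟨h1, hb⟩ := hj x
    have hGx : F^[j x] x ∈ D := hD ⟨x, hx, rfl⟩
    rcases lt_or_ge n (j x) with hlt | hge
    · refine ⟨j x - n, by omega, by omega, ?_⟩
      rwa [Nat.add_sub_cancel' hlt.le]
    · obtain ⟨k, hk1, hkb, hk⟩ := ih (n - j x) (by omega) _ hGx
      refine ⟨k, hk1, hkb, ?_⟩
      rw [← Function.iterate_add_apply] at hk
      rwa [show n + k = n - j x + k + j x by omega]
end

section
/- Transitivity of piecewise iterates: Let X be a topological space and F : X → X continuous. Let j, m : X → ℕ be locally constant functions and b₁, b₂ ∈ ℕ with 1 ≤ j x ≤ b₁ and 1 ≤ m x ≤ b₂ for all x ∈ X. Define G x = F^[j x] x and H x = G^[m x] x. Then there exists a locally constant function n : X → ℕ with 1 ≤ n x ≤ b₁ · b₂ for all x, such that H x = F^[n x] x for all x ∈ X. -/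
/-- Selecting among continuous maps by a locally constant index gives a continuous map. -/
theorem IsLocallyConstant.continuous_select {ι X Y : Type*} [TopologicalSpace X]
    [TopologicalSpace Y] {g : X → ι} (hg : IsLocallyConstant g) {f : ι → X → Y}
    (hf : ∀ i, Continuous (f i)) : Continuous fun x => f (g x) x := by
  rw [continuous_iff_continuousAt]
  intro x
  refine (hf (g x)).continuousAt.congr ?_
  filter_upwards [hg.eventually_eq x] with y hy
  rw [hy]

/-- An iterate of `y ↦ F^[j y] y` is an iterate of `F`, the exponent being the Birkhoff sum
of `j`. -/
theorem iterate_piecewise_iterate {X : Type*} (F : X → X) (j : X → ℕ) (k : ℕ) (x : X) :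
    (fun y => F^[j y] y)^[k] x = F^[birkhoffSum (fun y => F^[j y] y) j k x] x := by
  induction k with
  | zero => simp
  | succ k ih =>
    rw [Function.iterate_succ_apply', birkhoffSum_succ, add_comm, Function.iterate_add_apply,
      ← ih]

/-- Transitivity of piecewise combinations of iterates: a piecewise combination
of iterates of a piecewise combination of iterates of `F` is itself a piecewise
combination of iterates of `F`, with bound the product of the bounds. -/
theorem piecewise_iterates_trans (X : Type*) [TopologicalSpace X] (F : X → X)
    (hF : Continuous F) (j m : X → ℕ) (hj : IsLocallyConstant j)
    (hm : IsLocallyConstant m) (b₁ b₂ : ℕ)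
    (hjb : ∀ x : X, 1 ≤ j x ∧ j x ≤ b₁) (hmb : ∀ x : X, 1 ≤ m x ∧ m x ≤ b₂) :
    ∃ n : X → ℕ, IsLocallyConstant n ∧ (∀ x : X, 1 ≤ n x ∧ n x ≤ b₁ * b₂) ∧
      ∀ x : X, (fun y => F^[j y] y)^[m x] x = F^[n x] x := by
  have hG : Continuous fun y => F^[j y] y := hj.continuous_select hF.iterate
  have hS (k : ℕ) : Continuous (birkhoffSum (fun y => F^[j y] y) j k) :=
    continuous_finsetSum _ fun i _ => hj.continuous.comp (hG.iterate i)
  refine ⟨fun x => birkhoffSum (fun y => F^[j y] y) j (m x) x,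
    (IsLocallyConstant.iff_continuous _).2 (hm.continuous_select hS), fun x => ⟨?_, ?_⟩,
    fun x => iterate_piecewise_iterate F j (m x) x⟩
  · calc 1 ≤ m x := (hmb x).1
      _ = ∑ _i ∈ Finset.range (m x), 1 := by simp
      _ ≤ _ := Finset.sum_le_sum fun i _ => (hjb _).1
  · calc birkhoffSum (fun y => F^[j y] y) j (m x) x
        ≤ ∑ _i ∈ Finset.range (m x), b₁ := Finset.sum_le_sum fun i _ => (hjb _).2
      _ = b₁ * m x := by simp [mul_comm]
      _ ≤ b₁ * b₂ := Nat.mul_le_mul_left _ (hmb x).2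
end

section
/- Neighborhood periodicity lemma: Let C be a nonempty closed subset of Cantor space, let F : (ℕ → Bool) → (ℕ → Bool) be continuous with F '' C ⊆ C, and let i ∈ ℕ. Then there exist a nonempty closed set D ⊆ C with F '' D ⊆ D and b ∈ ℕ such that for every x ∈ D and every n ∈ ℕ there exists k < b with (F^[n+k] x) m = x m for all m < i. -/
open Set

/-- Every nonempty closed forward-invariant set in a compact space contains a minimal one. -/
theorem IsClosed.exists_minimal_mapsTo {X : Type*} [TopologicalSpace X] [CompactSpace X]
    {F : X → X} {C : Set X} (hC : IsClosed C) (hne : C.Nonempty) (hFC : MapsTo F C C) :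
    ∃ D ⊆ C, Minimal (fun E ↦ E.Nonempty ∧ IsClosed E ∧ MapsTo F E E) D := by
  refine zorn_superset_nonempty {E | E.Nonempty ∧ IsClosed E ∧ MapsTo F E E} ?_ C ⟨hne, hC, hFC⟩
  intro c hc hchain hcne
  have : Nonempty c := hcne.to_subtype
  refine ⟨⋂₀ c, ⟨?_, isClosed_sInter fun E hE ↦ (hc hE).2.1, ?_⟩,
    fun E hE ↦ sInter_subset_of_mem hE⟩
  · exact IsCompact.nonempty_sInter_of_directed_nonempty_isCompact_isClosed
      (fun A hA B hB ↦ (hchain.total hA hB).elim (fun h ↦ ⟨A, hA, Subset.rfl, h⟩)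
        fun h ↦ ⟨B, hB, h, Subset.rfl⟩)
      (fun E hE ↦ (hc hE).1) (fun E hE ↦ (hc hE).2.1.isCompact) fun E hE ↦ (hc hE).2.1
  · exact fun x hx E hE ↦ (hc hE).2.2 (hx E hE)

/-- In a minimal closed forward-invariant set, all orbits enter a given relatively nonempty open
set within uniformly bounded time. -/
theorem Minimal.exists_forall_exists_iterate_mem {X : Type*} [TopologicalSpace X] [CompactSpace X]
    {F : X → X} (hF : Continuous F) {D U : Set X}
    (hD : Minimal (fun E ↦ E.Nonempty ∧ IsClosed E ∧ MapsTo F E E) D)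
    (hU : IsOpen U) (hDU : (D ∩ U).Nonempty) :
    ∃ b : ℕ, ∀ y ∈ D, ∃ k < b, F^[k] y ∈ U := by
  obtain ⟨-, hDcl, hDF⟩ := hD.prop
  have hopen (k : ℕ) : IsOpen (F^[k] ⁻¹' U) := hU.preimage (hF.iterate k)
  have hcover : D ⊆ ⋃ b : ℕ, ⋃ k < b, F^[k] ⁻¹' U := by
    by_contra hnot
    obtain ⟨y, hyD, hy⟩ := not_subset.mp hnot
    have hE : D ⊆ D ∩ ⋂ k : ℕ, (F^[k] ⁻¹' U)ᶜ := by
      refine hD.le_of_le ⟨⟨y, hyD, ?_⟩, ?_, ?_⟩ inter_subset_left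
      · refine mem_iInter.mpr fun k hk ↦ hy ?_
        exact mem_iUnion.mpr ⟨k + 1, mem_iUnion₂.mpr ⟨k, k.lt_succ_self, hk⟩⟩
      · exact hDcl.inter (isClosed_iInter fun k ↦ (hopen k).isClosed_compl)
      · exact fun z hz ↦ ⟨hDF hz.1, mem_iInter.mpr fun k ↦ mem_iInter.mp hz.2 (k + 1)⟩
    obtain ⟨x, hxD, hxU⟩ := hDU
    exact mem_iInter.mp (hE hxD).2 0 hxU
  obtain ⟨b, hb⟩ := hDcl.isCompact.elim_directed_cover _
    (fun b ↦ isOpen_iUnion fun k ↦ isOpen_iUnion fun _ ↦ hopen k) hcover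
    (Monotone.directed_le fun a b hab ↦
      biUnion_subset_biUnion_left fun k (hk : k < a) ↦ hk.trans_le hab)
  exact ⟨b, fun y hy ↦ by simpa using hb hy⟩

/-- Neighborhood periodicity lemma: inside any nonempty closed invariant subset
`C` of Cantor space there is a nonempty closed invariant subset `D` and a bound
`b` such that the orbit of any point of `D` returns, with gaps less than `b`,
to the length-`i` cylinder of that point. -/
theorem neighborhood_periodicity (C : Set (ℕ → Bool)) (hCne : C.Nonempty)
    (hCcl : IsClosed C) (F : (ℕ → Bool) → (ℕ → Bool)) (hF : Continuous F)
    (hFC : F '' C ⊆ C) (i : ℕ) :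
    ∃ (D : Set (ℕ → Bool)) (b : ℕ), D.Nonempty ∧ IsClosed D ∧ D ⊆ C ∧
      F '' D ⊆ D ∧
      ∀ x ∈ D, ∀ n : ℕ, ∃ k < b, ∀ m < i, (F^[n + k] x) m = x m := by
  obtain ⟨D, hDC, hD⟩ := hCcl.exists_minimal_mapsTo hCne (mapsTo_iff_image_subset.mpr hFC)
  obtain ⟨hDne, hDcl, hDF⟩ := hD.prop
  let r (x : ℕ → Bool) (m : Fin i) : Bool := x m
  have hr : Continuous r := by fun_prop
  have hbound (w : Fin i → Bool) :
      ∃ b : ℕ, (D ∩ r ⁻¹' {w}).Nonempty → ∀ y ∈ D, ∃ k < b, r (F^[k] y) = w := by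
    by_cases hw : (D ∩ r ⁻¹' {w}).Nonempty
    · obtain ⟨b, hb⟩ :=
        hD.exists_forall_exists_iterate_mem hF ((isOpen_discrete {w}).preimage hr) hw
      exact ⟨b, fun _ ↦ hb⟩
    · exact ⟨0, fun h ↦ absurd h hw⟩
  choose b hb using hbound
  refine ⟨D, Finset.univ.sup b, hDne, hDcl, hDC, hDF.image_subset, fun x hx n ↦ ?_⟩
  obtain ⟨k, hk, hkx⟩ := hb (r x) ⟨x, hx, rfl⟩ (F^[n] x) (hDF.iterate n hx)
  refine ⟨k, hk.trans_le (Finset.le_sup (Finset.mem_univ _)), fun m hm ↦ ?_⟩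
  rw [add_comm, Function.iterate_add_apply]
  exact congrFun hkx ⟨m, hm⟩
end

section
/- Recurrent points of the searching system are paths: Let T be a set of finite strings over Fin 3 (lists with entries in {0,1,2}) such that no element of T contains an entry equal to 2, T is closed under taking prefixes, the empty string belongs to T, and T is infinite. Define F : (ℕ → Fin 3) → (ℕ → Fin 3) as follows: if every finite initial segment of X belongs to T, then F X = X; otherwise, letting π be the shortest initial segment of X not in T: if π = ρ ++ [0] or π = ρ ++ [0,2] for some string ρ, then F X is the sequence ρ followed by 1 followed by infinitely many 0's; if π = ρ ++ [1] or π = ρ ++ [1,2], then F X is ρ followed by 2 followed by infinitely many 0's; if π = [2], then F X is the all-0 sequence. Then every recurrent point X of F (i.e., every X such that for all c ∈ ℕ and all N ∈ ℕ there exists n ≥ N with (F^[n] X) m = X m for all m < c) has all of its finite initial segments in T. -/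
/-- The initial segment of length `l` of a sequence `X : ℕ → Fin 3`. -/
def seg3 (X : ℕ → Fin 3) (l : ℕ) : List (Fin 3) :=
  List.ofFn fun i : Fin l => X i

/-- `π` is the shortest initial segment of `X` that is not in `T`. -/
def ShortestNotIn (T : Set (List (Fin 3))) (X : ℕ → Fin 3)
    (π : List (Fin 3)) : Prop :=
  π = seg3 X π.length ∧ π ∉ T ∧ ∀ l < π.length, seg3 X l ∈ T

/-- The sequence consisting of `ρ`, followed by `a`, followed by infinitely
many `0`'s. -/
def extSeq (ρ : List (Fin 3)) (a : Fin 3) : ℕ → Fin 3 := fun n =>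
  if h : n < ρ.length then ρ.get ⟨n, h⟩ else if n = ρ.length then a else 0

/-- All initial segments of `X` belong to `T`. -/
def IsPathOf (T : Set (List (Fin 3))) (X : ℕ → Fin 3) : Prop :=
  ∀ l : ℕ, seg3 X l ∈ T

theorem seg3_succ (X : ℕ → Fin 3) (m : ℕ) : seg3 X (m + 1) = seg3 X m ++ [X m] := by
  simp only [seg3, List.ofFn_succ_last, Fin.val_castSucc, Fin.val_last]

theorem seg3_length (X : ℕ → Fin 3) (l : ℕ) : (seg3 X l).length = l := by
  simp [seg3]

theorem mem_seg3 {X : ℕ → Fin 3} {i l : ℕ} (h : i < l) : X i ∈ seg3 X l := by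
  simp only [seg3, List.mem_ofFn]
  exact ⟨⟨i, h⟩, rfl⟩

theorem seg3_congr {X Y : ℕ → Fin 3} {l : ℕ} (h : ∀ i < l, Y i = X i) :
    seg3 Y l = seg3 X l := by
  simp only [seg3]
  congr 1
  funext i
  exact h i i.2

theorem seg3_isPrefix (X : ℕ → Fin 3) {l m : ℕ} (h : l ≤ m) : seg3 X l <+: seg3 X m := by
  induction m, h using Nat.le_induction with
  | base => exact List.prefix_rfl
  | succ m _ ih =>
    rw [seg3_succ]
    exact ih.trans (List.prefix_append _ _)

theorem extSeq_seg3_of_lt (X : ℕ → Fin 3) (a : Fin 3) {m n : ℕ} (h : n < m) :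
    extSeq (seg3 X m) a n = X n := by
  simp [extSeq, seg3, h]

theorem extSeq_seg3_self (X : ℕ → Fin 3) (a : Fin 3) (m : ℕ) :
    extSeq (seg3 X m) a m = a := by
  simp [extSeq, seg3]

theorem extSeq_seg3_of_gt (X : ℕ → Fin 3) (a : Fin 3) {m n : ℕ} (h : m < n) :
    extSeq (seg3 X m) a n = 0 := by
  simp [extSeq, seg3, h.not_gt, h.ne']

/-- An infinite tree of strings over `Fin 3` has a path. -/
theorem exists_isPathOf {T : Set (List (Fin 3))}
    (hTpref : ∀ σ τ : List (Fin 3), σ <+: τ → τ ∈ T → σ ∈ T) (hTinf : T.Infinite) :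
    ∃ P, IsPathOf T P := by
  have hclosed : ∀ l, IsClosed {X : ℕ → Fin 3 | seg3 X l ∈ T} := by
    intro l
    have hc : Continuous fun (X : ℕ → Fin 3) (i : Fin l) => X i := by fun_prop
    exact (isClosed_discrete {f : Fin l → Fin 3 | List.ofFn f ∈ T}).preimage hc
  have hne : (⋂ l, {X : ℕ → Fin 3 | seg3 X l ∈ T}).Nonempty := by
    refine IsCompact.nonempty_iInter_of_sequence_nonempty_isCompact_isClosed _ ?_ ?_
      (hclosed 0).isCompact hclosed
    · exact fun l X hX => hTpref _ _ (seg3_isPrefix X l.le_succ) hX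
    · intro l
      obtain ⟨τ, hτ, hlen⟩ : ∃ τ ∈ T, l ≤ τ.length := by
        by_contra! h
        exact hTinf ((List.finite_length_lt (Fin 3) l).subset h)
      refine ⟨fun n => τ.getD n 0, hTpref _ _ ?_ hτ⟩
      rw [List.prefix_iff_eq_take, seg3_length]
      refine List.ext_getElem (by simp [seg3_length, hlen]) fun i h₁ h₂ => ?_
      have hi : i < τ.length := (seg3_length _ l ▸ h₁).trans_le hlen
      simp [seg3, hi]
  obtain ⟨P, hP⟩ := hne
  exact ⟨P, Set.mem_iInter.1 hP⟩

/-- The searching map of `T`: it fixes the paths of `T`, and otherwise changes the sequence at the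
end of its shortest initial segment outside `T`. -/
structure IsSearchingMap (T : Set (List (Fin 3))) (F : (ℕ → Fin 3) → (ℕ → Fin 3)) : Prop where
  two_notMem : ∀ σ ∈ T, (2 : Fin 3) ∉ σ
  nil_mem : ([] : List (Fin 3)) ∈ T
  fix : ∀ X : ℕ → Fin 3, (∀ l : ℕ, seg3 X l ∈ T) → F X = X
  zero : ∀ (X : ℕ → Fin 3) (π ρ : List (Fin 3)), ShortestNotIn T X π →
    (π = ρ ++ [0] ∨ π = ρ ++ [0, 2]) → F X = extSeq ρ 1
  one : ∀ (X : ℕ → Fin 3) (π ρ : List (Fin 3)), ShortestNotIn T X π →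
    (π = ρ ++ [1] ∨ π = ρ ++ [1, 2]) → F X = extSeq ρ 2
  two : ∀ (X : ℕ → Fin 3) (π : List (Fin 3)), ShortestNotIn T X π →
    π = [2] → F X = fun _ => 0

/-- `Z` arises from `X` by incrementing the entry at `k` and erasing all later entries. -/
structure IncrementsAt (X Z : ℕ → Fin 3) (k : ℕ) : Prop where
  eq_of_lt : ∀ i < k, Z i = X i
  val_eq : (Z k).val = (X k).val + 1
  eq_zero : ∀ i, k < i → Z i = 0

theorem incrementsAt_extSeq {X : ℕ → Fin 3} {k : ℕ} {a : Fin 3} (h : a.val = (X k).val + 1) :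
    IncrementsAt X (extSeq (seg3 X k) a) k where
  eq_of_lt _ hi := extSeq_seg3_of_lt X a hi
  val_eq := by rw [extSeq_seg3_self, h]
  eq_zero _ hi := extSeq_seg3_of_gt X a hi

theorem IncrementsAt.toLex_lt {X Z : ℕ → Fin 3} {k : ℕ} (h : IncrementsAt X Z k) :
    toLex X < toLex Z :=
  ⟨k, fun i hi => (h.eq_of_lt i hi).symm, by
    change X k < Z k
    rw [Fin.lt_def, h.val_eq]
    omega⟩

namespace IsSearchingMap

variable {T : Set (List (Fin 3))} {F : (ℕ → Fin 3) → (ℕ → Fin 3)}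

theorem path_ne_two (hF : IsSearchingMap T F) {P : ℕ → Fin 3} (hP : IsPathOf T P) (i : ℕ) :
    P i ≠ 2 :=
  fun h => hF.two_notMem _ (hP (i + 1)) (h ▸ mem_seg3 i.lt_succ_self)

/-- Off the paths, the searching map acts uniformly on a cylinder: it wraps around to `0` or
increments an entry within the cylinder. -/
theorem exists_step (hF : IsSearchingMap T F) {X : ℕ → Fin 3} (hX : ¬ IsPathOf T X) :
    ∃ c, (0 < c ∧ X 0 = 2 ∧ ∀ Y, (∀ i < c, Y i = X i) → F Y = fun _ => 0) ∨
      ∃ k < c, (∀ Y, (∀ i < c, Y i = X i) → IncrementsAt X (F Y) k) ∧ X 0 ≠ 2 ∧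
        ∀ P, IsPathOf T P → (∀ i ≤ k, P i = X i) → X (k + 1) = 2 := by
  classical
  have hex : ∃ l, seg3 X l ∉ T := not_forall.1 hX
  obtain ⟨c, hc, hmin⟩ : ∃ c, seg3 X c ∉ T ∧ ∀ l < c, seg3 X l ∈ T :=
    ⟨Nat.find hex, Nat.find_spec hex, fun l hl => not_not.1 (Nat.find_min hex hl)⟩
  have hshort : ∀ Y : ℕ → Fin 3, (∀ i < c, Y i = X i) → ShortestNotIn T Y (seg3 X c) := by
    intro Y hY
    refine ⟨?_, hc, fun l hl => ?_⟩
    · rw [seg3_length, seg3_congr hY]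
    · rw [seg3_length] at hl
      rw [seg3_congr fun i hi => hY i (hi.trans hl)]
      exact hmin l hl
  have htwo : ∀ i, i + 1 < c → X i ≠ 2 := fun i hi h =>
    hF.two_notMem _ (hmin _ hi) (h ▸ mem_seg3 i.lt_succ_self)
  have hcases : ∀ a : Fin 3, a = 0 ∨ a = 1 ∨ a = 2 := by decide
  refine ⟨c, ?_⟩
  obtain _ | m := c
  · exact absurd hF.nil_mem (by simpa [seg3] using hc)
  have hlast : X m ≠ 2 → X 0 ≠ 2 := by
    intro h
    obtain _ | m := m
    · exact h
    · exact htwo 0 (by omega)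
  have hpath : ∀ P, IsPathOf T P → (∀ i ≤ m, P i = X i) → X (m + 1) = 2 := by
    intro P hP h
    refine absurd (hP (m + 1)) ?_
    rwa [seg3_congr fun i hi => h i (by omega)]
  rcases hcases (X m) with hm | hm | hm
  · refine Or.inr ⟨m, m.lt_succ_self, fun Y hY => ?_, hlast (by simp [hm]), hpath⟩
    rw [hF.zero Y _ (seg3 X m) (hshort Y hY) (Or.inl (by rw [seg3_succ, hm]))]
    exact incrementsAt_extSeq (by simp [hm])
  · refine Or.inr ⟨m, m.lt_succ_self, fun Y hY => ?_, hlast (by simp [hm]), hpath⟩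
    rw [hF.one Y _ (seg3 X m) (hshort Y hY) (Or.inl (by rw [seg3_succ, hm]))]
    exact incrementsAt_extSeq (by simp [hm])
  obtain _ | m := m
  · exact Or.inl ⟨one_pos, hm, fun Y hY => hF.two Y _ (hshort Y hY) (by simp [seg3, hm])⟩
  refine Or.inr ⟨m, by omega, fun Y hY => ?_, htwo 0 (by omega), fun _ _ _ => hm⟩
  rcases hcases (X m) with hm' | hm' | hm'
  · rw [hF.zero Y _ (seg3 X m) (hshort Y hY) (Or.inr (by simp [seg3_succ, hm, hm']))]
    exact incrementsAt_extSeq (by simp [hm'])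
  · rw [hF.one Y _ (seg3 X m) (hshort Y hY) (Or.inr (by simp [seg3_succ, hm, hm']))]
    exact incrementsAt_extSeq (by simp [hm'])
  · exact absurd hm' (htwo m (by omega))

theorem apply_eq_zero (hF : IsSearchingMap T F) {X : ℕ → Fin 3} (h : X 0 = 2) :
    F X = fun _ => 0 := by
  obtain ⟨c, ⟨-, -, hc⟩ | ⟨k, -, -, h0, -⟩⟩ := hF.exists_step fun hX => hF.path_ne_two hX 0 h
  · exact hc X fun _ _ => rfl
  · exact absurd h h0

theorem toLex_le_apply (hF : IsSearchingMap T F) {X : ℕ → Fin 3} (h : X 0 ≠ 2) :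
    toLex X ≤ toLex (F X) := by
  by_cases hX : IsPathOf T X
  · rw [hF.fix X hX]
  obtain ⟨c, ⟨-, h2, -⟩ | ⟨k, -, hk, -⟩⟩ := hF.exists_step hX
  · exact absurd h2 h
  · exact (hk X fun _ _ => rfl).toLex_lt.le

theorem ne_two_of_toLex_le (hF : IsSearchingMap T F) {X P : ℕ → Fin 3} (hP : IsPathOf T P)
    (h : toLex X ≤ toLex P) : X 0 ≠ 2 := by
  intro h2
  have hP2 := hF.path_ne_two hP 0
  rcases h.eq_or_lt with h | ⟨j, hj, hlt⟩
  · exact hP2 (toLex_inj.1 h ▸ h2)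
  obtain _ | j := j
  · change X 0 < P 0 at hlt
    omega
  · exact hP2 ((hj 0 j.succ_pos).symm.trans h2)

/-- The searching map does not jump over a path. -/
theorem toLex_apply_le (hF : IsSearchingMap T F) {X P : ℕ → Fin 3} (hP : IsPathOf T P)
    (h : toLex X ≤ toLex P) : toLex (F X) ≤ toLex P := by
  by_cases hX : IsPathOf T X
  · rwa [hF.fix X hX]
  obtain ⟨c, ⟨-, h2, -⟩ | ⟨k, -, hk, -, hnext⟩⟩ := hF.exists_step hX
  · exact absurd h2 (hF.ne_two_of_toLex_le hP h)
  obtain ⟨hlow, hval, hzero⟩ := hk X fun _ _ => rfl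
  rcases h.eq_or_lt with h | ⟨j, hj, hlt⟩
  · exact absurd (toLex_inj.1 h ▸ hP) hX
  replace hj : ∀ i < j, X i = P i := hj
  replace hlt : X j < P j := hlt
  rcases lt_trichotomy j k with hjk | rfl | hjk
  · refine le_of_lt ⟨j, fun i hi => ?_, ?_⟩
    · exact (hlow i (hi.trans hjk)).trans (hj i hi)
    · exact (hlow j hjk).trans_lt hlt
  · refine Pi.toLex_monotone fun i => ?_
    rcases lt_trichotomy i j with hi | rfl | hi
    · exact ((hlow i hi).trans (hj i hi)).le
    · rw [Fin.le_def, hval]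
      exact hlt
    · rw [hzero i hi]
      exact Fin.zero_le _
  · have hX2 := hnext P hP fun i hi => (hj i (by omega)).symm
    rcases (Nat.succ_le_of_lt hjk).eq_or_lt with rfl | hlt'
    · rw [Nat.succ_eq_add_one, hX2] at hlt
      omega
    · exact absurd ((hj _ hlt').symm.trans hX2) (hF.path_ne_two hP _)

/-- Every orbit of the searching map is eventually increasing in the lexicographic order. -/
theorem exists_monotone_orbit (hF : IsSearchingMap T F) {P : ℕ → Fin 3} (hP : IsPathOf T P)
    (X : ℕ → Fin 3) : ∃ N, Monotone fun n => toLex (F^[N + n] X) := by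
  have key : ∀ N, (∀ n, F^[N + n] X 0 ≠ 2) → Monotone fun n => toLex (F^[N + n] X) := by
    refine fun N h => monotone_nat_of_le_succ fun n => ?_
    rw [← add_assoc, Function.iterate_succ_apply']
    exact hF.toLex_le_apply (h n)
  by_cases h : ∃ n, F^[n] X 0 = 2
  · obtain ⟨n, hn⟩ := h
    refine ⟨n + 1, key _ fun m => hF.ne_two_of_toLex_le hP ?_⟩
    induction m with
    | zero =>
      rw [add_zero, Function.iterate_succ_apply', hF.apply_eq_zero hn]
      exact Pi.toLex_monotone fun i => Fin.zero_le _
    | succ m ih =>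
      rw [← add_assoc, Function.iterate_succ_apply']
      exact hF.toLex_apply_le hP ih
  · push Not at h
    exact ⟨0, key 0 fun n => h _⟩

end IsSearchingMap

theorem toLex_restrict_monotone (c : ℕ) :
    Monotone fun X : Lex (ℕ → Fin 3) => toLex fun i : Fin c => ofLex X i := by
  intro X Y h
  rcases h.eq_or_lt with rfl | ⟨j, hj, hlt⟩
  · exact le_rfl
  by_cases hjc : j < c
  · exact le_of_lt ⟨⟨j, hjc⟩, fun i hi => hj i hi, hlt⟩
  · exact le_of_eq (congrArg toLex (funext fun i => hj i (by omega)))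

/-- An increasing sequence in the lexicographic order is eventually constant on every finite set
of coordinates. -/
theorem Monotone.exists_eventually_agree {Y : ℕ → ℕ → Fin 3}
    (hY : Monotone fun n => toLex (Y n)) (c : ℕ) : ∃ M, ∀ n ≥ M, ∀ i < c, Y n i = Y M i := by
  have : Finite (Lex (Fin c → Fin 3)) := inferInstanceAs (Finite (Fin c → Fin 3))
  obtain ⟨M, hM⟩ := WellFoundedGT.monotone_chain_condition
    (⟨_, (toLex_restrict_monotone c).comp hY⟩ : ℕ →o Lex (Fin c → Fin 3))
  exact ⟨M, fun n hn i hi => (congrFun (toLex_inj.1 (hM n hn)) ⟨i, hi⟩).symm⟩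

/-- Recurrent points of the searching system are paths: given an infinite
prefix-closed set `T` of strings over `Fin 3` none of whose elements contains
a `2`, and the searching map `F` (fixing paths of `T` and otherwise moving in
increasing lexicographic order, looping around on a `2`), every recurrent
point of `F` has all of its finite initial segments in `T`. -/
theorem recurrent_point_of_searching_system_is_path
    (T : Set (List (Fin 3)))
    (hT2 : ∀ σ ∈ T, (2 : Fin 3) ∉ σ)
    (hTpref : ∀ σ τ : List (Fin 3), σ <+: τ → τ ∈ T → σ ∈ T)
    (hTnil : ([] : List (Fin 3)) ∈ T)
    (hTinf : T.Infinite)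
    (F : (ℕ → Fin 3) → (ℕ → Fin 3))
    (hFfix : ∀ X : ℕ → Fin 3, (∀ l : ℕ, seg3 X l ∈ T) → F X = X)
    (hF0 : ∀ (X : ℕ → Fin 3) (π ρ : List (Fin 3)), ShortestNotIn T X π →
      (π = ρ ++ [0] ∨ π = ρ ++ [0, 2]) → F X = extSeq ρ 1)
    (hF1 : ∀ (X : ℕ → Fin 3) (π ρ : List (Fin 3)), ShortestNotIn T X π →
      (π = ρ ++ [1] ∨ π = ρ ++ [1, 2]) → F X = extSeq ρ 2)
    (hF2 : ∀ (X : ℕ → Fin 3) (π : List (Fin 3)), ShortestNotIn T X π →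
      π = [2] → F X = fun _ => 0)
    (X : ℕ → Fin 3)
    (hrec : ∀ c N : ℕ, ∃ n ≥ N, ∀ m < c, (F^[n] X) m = X m) :
    ∀ l : ℕ, seg3 X l ∈ T := by
  intro l
  have hF : IsSearchingMap T F := ⟨hT2, hTnil, hFfix, hF0, hF1, hF2⟩
  obtain ⟨P, hP⟩ := exists_isPathOf hTpref hTinf
  obtain ⟨N, hmono⟩ := hF.exists_monotone_orbit hP X
  suffices hX : IsPathOf T X from hX l
  by_contra hX
  obtain ⟨c, hc⟩ := hF.exists_step hX
  obtain ⟨M, hM⟩ := hmono.exists_eventually_agree c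
  obtain ⟨n, hn, hnX⟩ := hrec c (N + M)
  have hlim : ∀ m ≥ M, ∀ i < c, F^[N + m] X i = X i := by
    intro m hm i hi
    rw [hM m hm i hi, ← hM (n - N) (by omega) i hi, Nat.add_sub_cancel' (by omega)]
    exact hnX i hi
  have hcur := hlim M le_rfl
  have hnext := hlim (M + 1) M.le_succ
  rw [← add_assoc, Function.iterate_succ_apply'] at hnext
  obtain ⟨hpos, h2, h0⟩ | ⟨k, hk, hinc, -⟩ := hc
  · have := hnext 0 hpos
    rw [h0 _ hcur, h2] at this
    exact absurd this (by decide)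
  · have := (hinc _ hcur).val_eq
    rw [hnext k hk] at this
    omega
end

section
/- Least-witness dichotomy along a refinement: Let C be a nonempty closed subset of Cantor space, let F : (ℕ → Bool) → (ℕ → Bool) be continuous with F '' C ⊆ C, and let (Wₘ)ₘ∈ℕ be a sequence of open subsets of Cantor space. Then there exist a nonempty closed set D ⊆ C, a number b' ∈ ℕ, and a locally constant function j : (ℕ → Bool) → ℕ with 1 ≤ j x ≤ b' for all x, such that the map G x := F^[j x] x satisfies G '' D ⊆ D, and moreover either (1) for every x ∈ D and every m ∈ ℕ, x ∉ Wₘ, or (2) there exists b ∈ ℕ such that for every x ∈ D, x ∈ W_b and x ∉ Wₘ for all m < b (so b is the least element of {m : x ∈ Wₘ} for every x ∈ D). -/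
open Set

/-- A continuous self-map of a closed set `C` in a compact space has a minimal nonempty closed
invariant set inside `C`. -/
theorem exists_minimal_closed_mapsTo {X : Type*} [TopologicalSpace X] [CompactSpace X]
    {F : X → X} {C : Set X} (hne : C.Nonempty) (hcl : IsClosed C) (hF : MapsTo F C C) :
    ∃ M ⊆ C, Minimal (fun S : Set X => S.Nonempty ∧ IsClosed S ∧ MapsTo F S S) M := by
  refine zorn_superset_nonempty {S | S.Nonempty ∧ IsClosed S ∧ MapsTo F S S} ?_ C ⟨hne, hcl, hF⟩
  intro c hc hchain hcne
  have : Nonempty c := hcne.to_subtype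
  refine ⟨⋂₀ c, ⟨?_, isClosed_sInter fun S hS => (hc hS).2.1, ?_⟩,
    fun S hS => sInter_subset_of_mem hS⟩
  · exact IsCompact.nonempty_sInter_of_directed_nonempty_isCompact_isClosed
      (fun S hS T hT => (hchain.total hS hT).elim (fun h => ⟨S, hS, subset_rfl, h⟩)
        fun h => ⟨T, hT, h, subset_rfl⟩)
      (fun S hS => (hc hS).1)
      (fun S hS => (hc hS).2.1.isCompact) (fun S hS => (hc hS).2.1)
  · intro x hx S hS
    exact (hc hS).2.2 (hx S hS)

/-- In a minimal closed invariant set, every orbit visits every open set meeting it. -/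
theorem exists_iterate_mem_of_minimal {X : Type*} [TopologicalSpace X] {F : X → X}
    (hF : Continuous F) {M U : Set X}
    (hM : Minimal (fun S : Set X => S.Nonempty ∧ IsClosed S ∧ MapsTo F S S) M)
    (hU : IsOpen U) (hMU : (M ∩ U).Nonempty) {x : X} (hx : x ∈ M) : ∃ n, F^[n] x ∈ U := by
  by_contra! h
  obtain ⟨y, hyM, hyU⟩ := hMU
  have hE : MapsTo F (M ∩ ⋂ n, F^[n] ⁻¹' Uᶜ) (M ∩ ⋂ n, F^[n] ⁻¹' Uᶜ) := by
    rintro z ⟨hzM, hz⟩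
    exact ⟨hM.prop.2.2 hzM, mem_iInter.2 fun n => mem_iInter.1 hz (n + 1)⟩
  have hcl : IsClosed (M ∩ ⋂ n, F^[n] ⁻¹' Uᶜ) :=
    hM.prop.2.1.inter (isClosed_iInter fun n => hU.isClosed_compl.preimage (hF.iterate n))
  have hsub := hM.le_of_le (y := M ∩ ⋂ n, F^[n] ⁻¹' Uᶜ)
    ⟨⟨x, hx, mem_iInter.2 h⟩, hcl, hE⟩ inter_subset_left
  exact mem_iInter.1 (hsub hyM).2 0 hyU

/-- Finitely many clopen sets admit a locally constant selection of the index of a set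
containing a given point, wherever there is one. -/
theorem exists_isLocallyConstant_index {X : Type*} [TopologicalSpace X] {V : ℕ → Set X}
    (hV : ∀ n, IsClopen (V n)) (N : ℕ) :
    ∃ j : X → ℕ, IsLocallyConstant j ∧ (∀ x, j x ≤ N) ∧
      ∀ x, (∃ n ≤ N, x ∈ V n) → x ∈ V (j x) := by
  classical
  induction N with
  | zero => exact ⟨fun _ => 0, IsLocallyConstant.const 0, by simp, by simp⟩
  | succ N ih =>
    obtain ⟨j, hj, hle, hmem⟩ := ih
    refine ⟨(V (N + 1)).piecewise (fun _ => N + 1) j, ?_, fun x => ?_, ?_⟩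
    · rw [IsLocallyConstant.iff_continuous] at hj ⊢
      exact continuous_const.piecewise (by simp [(hV (N + 1)).frontier_eq]) hj
    · by_cases hx : x ∈ V (N + 1)
      · simp [hx]
      · simpa [hx] using (hle x).trans N.le_succ
    · rintro x ⟨n, hn, hxn⟩
      by_cases hx : x ∈ V (N + 1)
      · simp [hx]
      · have hne : n ≠ N + 1 := by
          rintro rfl
          exact hx hxn
        simpa [hx] using hmem x ⟨n, by omega, hxn⟩


/-- Least-witness dichotomy along a refinement: given a nonempty closed
invariant subset `C` of Cantor space and a sequence of open sets `W m`, there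
is a nonempty closed subset `D ⊆ C`, invariant under a piecewise combination
`x ↦ F^[j x] x` of iterates of `F` (with locally constant `j` bounded by `b'`),
such that either no point of `D` lies in any `W m`, or there is a `b` which is
the least `m` with `x ∈ W m` for every `x ∈ D`. -/
theorem least_witness_dichotomy (C : Set (ℕ → Bool)) (hCne : C.Nonempty)
    (hCcl : IsClosed C) (F : (ℕ → Bool) → (ℕ → Bool)) (hF : Continuous F)
    (hFC : F '' C ⊆ C) (W : ℕ → Set (ℕ → Bool)) (hW : ∀ m, IsOpen (W m)) :
    ∃ (D : Set (ℕ → Bool)) (b' : ℕ) (j : (ℕ → Bool) → ℕ),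
      D.Nonempty ∧ IsClosed D ∧ D ⊆ C ∧
      IsLocallyConstant j ∧ (∀ x, 1 ≤ j x ∧ j x ≤ b') ∧
      (fun x => F^[j x] x) '' D ⊆ D ∧
      ((∀ x ∈ D, ∀ m : ℕ, x ∉ W m) ∨
        (∃ b : ℕ, ∀ x ∈ D, x ∈ W b ∧ ∀ m < b, x ∉ W m)) := by
  obtain ⟨M, hMC, hM⟩ := exists_minimal_closed_mapsTo hCne hCcl (mapsTo_iff_image_subset.2 hFC)
  obtain ⟨hMne, hMcl, hMF⟩ := hM.prop
  by_cases hmeet : ∃ m, (M ∩ W m).Nonempty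
  · classical
    obtain ⟨x₀, hx₀M, hx₀W⟩ := Nat.find_spec hmeet
    obtain ⟨U, hU, hx₀U, hUW⟩ := compact_exists_isClopen_in_isOpen (hW _) hx₀W
    have hV (n : ℕ) : IsClopen (F^[n + 1] ⁻¹' U) := hU.preimage (hF.iterate (n + 1))
    have hcover : M ⊆ ⋃ n, F^[n + 1] ⁻¹' U := fun x hx =>
      mem_iUnion.2 (exists_iterate_mem_of_minimal hF hM hU.isOpen ⟨x₀, hx₀M, hx₀U⟩ (hMF hx))
    obtain ⟨t, ht⟩ := hMcl.isCompact.elim_finite_subcover _ (fun n => (hV n).isOpen) hcover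
    obtain ⟨j, hj, hle, hmem⟩ := exists_isLocallyConstant_index hV (t.sup id)
    refine ⟨M ∩ U, t.sup id + 1, fun x => j x + 1, ⟨x₀, hx₀M, hx₀U⟩, hMcl.inter hU.isClosed,
      inter_subset_left.trans hMC, hj.comp (· + 1), fun x => ⟨by simp, by simpa using hle x⟩,
      ?_, Or.inr ⟨Nat.find hmeet, ?_⟩⟩
    · rintro _ ⟨x, ⟨hxM, -⟩, rfl⟩
      obtain ⟨n, hn, hxn⟩ := mem_iUnion₂.1 (ht hxM)
      exact ⟨hMF.iterate _ hxM, hmem x ⟨n, Finset.le_sup (f := id) hn, hxn⟩⟩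
    · rintro x ⟨hxM, hxU⟩
      exact ⟨hUW hxU, fun m hm hxm => Nat.find_min hmeet hm ⟨x, hxM, hxm⟩⟩
  · exact ⟨M, 1, fun _ => 1, hMne, hMcl, hMC, IsLocallyConstant.const 1, by simp,
      mapsTo_iff_image_subset.1 hMF, Or.inl fun x hx m hxm => hmeet ⟨m, x, hx, hxm⟩⟩
end
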